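/- Let 𝔽 be an algebraically closed field of characteristic zero and let u_1,…,u_m ∈ V. Then the O_n-orbit of the tuple (u_1,…,u_m) in V^m is Zariski-closed if and only if the restriction of the standard symmetric bilinear form to the linear span of u_1,…,u_m is nondegenerate. -/

import Mathlib

/-!
Formalization framework for "Partition functions of vertex models /
edge connection matrices" (Regts–Draisma style).

Graphs and fragments are finite multigraphs (allowing multiple edges, loops
and circles); a `k`-fragment additionally has `k` labelled open ends.  We
encode a `k`-fragment by a number `nv` of internal vertices, a number `ne`
of edges, and for each edge the multiset of its endpoints, each endpoint
being either an internal vertex (`Sum.inl`) or an open-end label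
(`Sum.inr`).  Every edge has `2` endpoints (counted with multiplicity; a
loop at `v` lists `v` twice) or `0` endpoints (a circle), and every label
occurs exactly once in total (the open ends have degree one).
-/

open MvPolynomial

namespace VertexModels

noncomputable section

/-- A `k`-fragment. For `k = 0` this is a graph. -/
structure Fragment (k : ℕ) : Type where
  nv : ℕ
  ne : ℕ
  inc : Fin ne → Multiset (Fin nv ⊕ Fin k)
  card_inc : ∀ e, Multiset.card (inc e) = 2 ∨ Multiset.card (inc e) = 0
  openEnd : ∀ j : Fin k, (∑ e, (inc e).count (Sum.inr j)) = 1

/-- A graph: a `0`-fragment. -/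
abbrev Graph := Fragment 0

/-- The basic `k`-fragment `F_k`: one internal vertex joined to each of the
`k` open ends by a half edge. -/
def basicFragment (k : ℕ) : Fragment k where
  nv := 1
  ne := k
  inc := fun e => {Sum.inl 0, Sum.inr e}
  card_inc := fun e => Or.inl (by simp)
  openEnd := fun j => by
    have h : ∀ e : Fin k,
        Multiset.count (Sum.inr j) ({Sum.inl 0, Sum.inr e} : Multiset (Fin 1 ⊕ Fin k))
          = if j = e then 1 else 0 := by
      intro e
      by_cases he : j = e <;>
        simp [Multiset.count_cons, Multiset.count_singleton, he]
    simp only [h]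
    simp

variable {𝔽 : Type} [Field 𝔽] {n : ℕ}

/-- A vertex model: a linear functional on `R = 𝔽[x_1, …, x_n]`. -/
abbrev VertexModel (𝔽 : Type) [Field 𝔽] (n : ℕ) : Type :=
  MvPolynomial (Fin n) 𝔽 →ₗ[𝔽] 𝔽

/-- The monomial `∏_{e ∈ δ(v)} x_{ψ(e)}` seen by the internal vertex `v` of a
fragment under the edge colouring `ψ`. -/
def monomialAt {k : ℕ} (F : Fragment k) (ψ : Fin F.ne → Fin n) (v : Fin F.nv) :
    MvPolynomial (Fin n) 𝔽 :=
  ∏ e, (X (ψ e) : MvPolynomial (Fin n) 𝔽) ^ ((F.inc e).count (Sum.inl v))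

/-- The partition function `f_h` of the vertex model `h`. -/
def partitionFun (h : VertexModel 𝔽 n) (G : Graph) : 𝔽 :=
  ∑ ψ : Fin G.ne → Fin n, ∏ v, h (monomialAt G ψ v)

/-- `h_φ(F)`, for a `k`-fragment `F` and a colouring `φ` of the open ends. -/
def hphi (h : VertexModel 𝔽 n) {k : ℕ} (F : Fragment k) (φ : Fin k → Fin n) : 𝔽 :=
  ∑ ψ ∈ Finset.univ.filter
      (fun ψ : Fin F.ne → Fin n => ∀ (e : Fin F.ne) (j : Fin k),
        Sum.inr j ∈ F.inc e → ψ e = φ j),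
    ∏ v, h (monomialAt F ψ v)

/-- `V^{⊗ k}` in coordinates: functions on multi-indices, with basis
`e_φ`. -/
abbrev Tensor (𝔽 : Type) [Field 𝔽] (n k : ℕ) : Type := (Fin k → Fin n) → 𝔽

/-- The tensor `p_h(F) = ∑_φ h_φ(F) e_φ ∈ V^{⊗ k}`. -/
def ph (h : VertexModel 𝔽 n) {k : ℕ} (F : Fragment k) : Tensor 𝔽 n k :=
  fun φ => hphi h F φ

/-- The standard bilinear form on `V^{⊗ k}`. -/
def tpair {k : ℕ} (t s : Tensor 𝔽 n k) : 𝔽 := ∑ φ, t φ * s φ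

/-- Tensor product `V^{⊗ k} × V^{⊗ l} → V^{⊗ (k+l)}`. -/
def tmul {k l : ℕ} (t : Tensor 𝔽 n k) (s : Tensor 𝔽 n l) : Tensor 𝔽 n (k + l) :=
  fun φ => t (fun i => φ (Fin.castAdd l i)) * s (fun i => φ (Fin.natAdd k i))

/-- The contraction `C^k_{i,j} : V^{⊗ k} → V^{⊗ (k-2)}` (here `k = m + 2`),
contracting the `i`-th and `j`-th tensor factors (`i < j`). -/
def tcontract {m : ℕ} (i j : Fin (m + 2)) (t : Tensor 𝔽 n (m + 2)) : Tensor 𝔽 n m :=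
  fun φ => ∑ c : Fin n,
    t (Fin.insertNth i c (Fin.insertNth (⟨j.1 - 1, by have := j.isLt; omega⟩ : Fin (m + 1)) c φ))

/-- The orthogonal group `O_n`, as the set of matrices `g` with `gᵀ g = 1`. -/
def orthSet (𝔽 : Type) [Field 𝔽] (n : ℕ) : Set (Matrix (Fin n) (Fin n) 𝔽) :=
  {g | g.transpose * g = 1}

/-- Substitution `X i ↦ ∑ j, g i j • X j`, i.e. composition of a polynomial
with the linear map `g`, as a linear endomorphism of `R`. -/
noncomputable def polSub (g : Matrix (Fin n) (Fin n) 𝔽) :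
    MvPolynomial (Fin n) 𝔽 →ₗ[𝔽] MvPolynomial (Fin n) 𝔽 :=
  (MvPolynomial.aeval (fun i => ∑ j, MvPolynomial.C (g i j) * X j)).toLinearMap

/-- The action of `g ∈ O_n` on vertex models: `(g h)(p) = h (p ∘ g) = h(g⁻¹ • p)`. -/
noncomputable def dualAct (g : Matrix (Fin n) (Fin n) 𝔽) (h : VertexModel 𝔽 n) :
    VertexModel 𝔽 n :=
  h.comp (polSub g)

/-- The stabilizer `Stab(h) = {g ∈ O_n ∣ g h = h}`. -/
noncomputable def Stab (h : VertexModel 𝔽 n) : Set (Matrix (Fin n) (Fin n) 𝔽) :=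
  {g | g ∈ orthSet 𝔽 n ∧ dualAct g h = h}

/-- The diagonal action of a matrix `g` on `V^{⊗ k}`. -/
def tact (g : Matrix (Fin n) (Fin n) 𝔽) (k : ℕ) :
    Tensor 𝔽 n k →ₗ[𝔽] Tensor 𝔽 n k :=
  Matrix.mulVecLin (Matrix.of fun φ ψ : Fin k → Fin n => ∏ i, g (φ i) (ψ i))

/-- The subspace `(V^{⊗ k})^S` of tensors fixed by every element of a set `S`
of matrices. -/
def invSub (S : Set (Matrix (Fin n) (Fin n) 𝔽)) (k : ℕ) :
    Submodule 𝔽 (Tensor 𝔽 n k) where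
  carrier := {t | ∀ g ∈ S, tact g k t = t}
  add_mem' := fun {a b} ha hb => by
    intro g hg
    rw [map_add, ha g hg, hb g hg]
  zero_mem' := by
    intro g hg
    rw [map_zero]
  smul_mem' := fun c a ha => by
    intro g hg
    rw [map_smul, ha g hg]

/-! ### Gluing two `k`-fragments into a graph -/

/-- `touches F H j a`: the edge `a` of the disjoint union of `F` and `H` is
incident with the open end labelled `j` (of its own fragment). -/
def touches {k : ℕ} (F H : Fragment k) (j : Fin k) : Fin F.ne ⊕ Fin H.ne → Prop
  | .inl e => Sum.inr j ∈ F.inc e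
  | .inr e => Sum.inr j ∈ H.inc e

/-- Edges of `F` and `H` which get merged into a single edge of `F * H` are
identified by the equivalence generated by sharing an open-end label. -/
def glueSetoid {k : ℕ} (F H : Fragment k) : Setoid (Fin F.ne ⊕ Fin H.ne) :=
  Relation.EqvGen.setoid (fun a b => ∃ j, touches F H j a ∧ touches F H j b)

/-- Number of edges of the glued graph `F * H`. -/
noncomputable def glueNE {k : ℕ} (F H : Fragment k) : ℕ :=
  Nat.card (Quotient (glueSetoid F H))

noncomputable def glueEquiv {k : ℕ} (F H : Fragment k) :
    Fin (glueNE F H) ≃ Quotient (glueSetoid F H) :=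
  (Finite.equivFin _).symm

/-- The internal (non-open-end) endpoints of an edge of the disjoint union,
re-indexed in `Fin (F.nv + H.nv)`. -/
def intEnds {k : ℕ} (F H : Fragment k) :
    Fin F.ne ⊕ Fin H.ne → Multiset (Fin (F.nv + H.nv) ⊕ Fin 0)
  | .inl e => (F.inc e).filterMap fun x =>
      match x with
      | .inl v => some (Sum.inl (Fin.castAdd H.nv v))
      | .inr _ => none
  | .inr e => (H.inc e).filterMap fun x =>
      match x with
      | .inl v => some (Sum.inl (Fin.natAdd F.nv v))
      | .inr _ => none

/-- Endpoints of an edge of the glued graph: the internal endpoints of all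
edges merged into it. -/
noncomputable def glueInc {k : ℕ} (F H : Fragment k) (c : Fin (glueNE F H)) :
    Multiset (Fin (F.nv + H.nv) ⊕ Fin 0) := by
  classical
  exact ∑ a ∈ Finset.univ.filter
    (fun a => Quotient.mk (glueSetoid F H) a = glueEquiv F H c), intEnds F H a

/-- The glued graph `F * H` of two `k`-fragments: connect the half edges
with equally labelled open ends into single edges (chains of half edges
closing up produce circles).  (The impossible degenerate branch is never
taken.) -/
noncomputable def glue {k : ℕ} (F H : Fragment k) : Graph := by
  classical
  exact if hc : ∀ c, Multiset.card (glueInc F H c) = 2 ∨ Multiset.card (glueInc F H c) = 0 then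
    { nv := F.nv + H.nv
      ne := glueNE F H
      inc := glueInc F H
      card_inc := hc
      openEnd := fun j => j.elim0 }
  else basicFragment 0

/-- The rank of the edge connection matrix `M_{f_h,k}` : the dimension of the
span of its rows. -/
noncomputable def connectionRank (h : VertexModel 𝔽 n) (k : ℕ) : ℕ :=
  Module.finrank 𝔽 (Submodule.span 𝔽
    (Set.range fun F : Fragment k => fun H : Fragment k => partitionFun h (glue F H)))

/-! ### The algebra `𝒜` of formal linear combinations of fragments -/

/-- `p_h` on formal linear combinations `𝔽ℱ_k` of `k`-fragments. -/
noncomputable def phL (h : VertexModel 𝔽 n) (k : ℕ) :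
    (Fragment k →₀ 𝔽) →ₗ[𝔽] Tensor 𝔽 n k :=
  Finsupp.linearCombination 𝔽 (fun F : Fragment k => ph h F)

/-- `γ ↦ (F ↦ f_h(γ * F))`: the bilinear extension of gluing followed by the
partition function.  Its kernel is `I_k`. -/
noncomputable def glueRow (h : VertexModel 𝔽 n) (k : ℕ) :
    (Fragment k →₀ 𝔽) →ₗ[𝔽] (Fragment k → 𝔽) :=
  Finsupp.linearCombination 𝔽
    (fun F : Fragment k => fun H : Fragment k => partitionFun h (glue F H))

/-- A vertex model is nondegenerate if `ker p_h = I`. -/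
def Nondeg (h : VertexModel 𝔽 n) : Prop :=
  ∀ (k : ℕ) (γ : Fragment k →₀ 𝔽), phL h k γ = 0 ↔ glueRow h k γ = 0

/-! ### The product of fragments and the contraction of fragments -/

/-- Endpoint multisets of the disjoint union `F H` of fragments (`H`'s open
ends relabelled by `i ↦ k + i`). -/
def mulInc {k l : ℕ} (F : Fragment k) (H : Fragment l) :
    Fin (F.ne + H.ne) → Multiset (Fin (F.nv + H.nv) ⊕ Fin (k + l)) :=
  Fin.addCases
    (fun e => (F.inc e).map (Sum.map (Fin.castAdd H.nv) (Fin.castAdd l)))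
    (fun e => (H.inc e).map (Sum.map (Fin.natAdd F.nv) (Fin.natAdd k)))

/-- The product `F H` in the fragment algebra `𝒜`: disjoint union, with the
open ends of `H` relabelled `i ↦ k + i`.  (The impossible degenerate branch
is never taken.) -/
noncomputable def fragMul {k l : ℕ} (F : Fragment k) (H : Fragment l) :
    Fragment (k + l) := by
  classical
  exact if hc : (∀ e, Multiset.card (mulInc F H e) = 2 ∨ Multiset.card (mulInc F H e) = 0)
      ∧ (∀ j : Fin (k + l), (∑ e, (mulInc F H e).count (Sum.inr j)) = 1) then
    { nv := F.nv + H.nv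
      ne := F.ne + H.ne
      inc := mulInc F H
      card_inc := hc.1
      openEnd := hc.2 }
  else basicFragment (k + l)

/-- Relabelling map for labels after removing labels `i` and `j` (`i < j`),
preserving the order of the remaining labels. -/
def downLabel {m : ℕ} (i j l : Fin (m + 2)) (hij : i < j) (h : ¬(l = i ∨ l = j)) : Fin m :=
  ⟨l.1 - (if i.1 < l.1 then 1 else 0) - (if j.1 < l.1 then 1 else 0), by
    push_neg at h
    have h1 : l.1 ≠ i.1 := fun hh => h.1 (Fin.ext hh)
    have h2 : l.1 ≠ j.1 := fun hh => h.2 (Fin.ext hh)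
    have h3 : i.1 < j.1 := hij
    have h4 := l.isLt
    have h6 := j.isLt
    split_ifs <;> omega⟩

/-- Removing the open ends `i` and `j` from an endpoint multiset and
relabelling the remaining open ends. -/
def removeEnd {m nv : ℕ} (i j : Fin (m + 2)) (hij : i < j) :
    Fin nv ⊕ Fin (m + 2) → Option (Fin nv ⊕ Fin m)
  | .inl v => some (.inl v)
  | .inr l => if h : l = i ∨ l = j then none else some (.inr (downLabel i j l hij h))

/-- Edges merged by the contraction `Γ^k_{i,j}`: those incident with the open
end `i` or the open end `j`. -/
def contractSetoid {m : ℕ} (F : Fragment (m + 2)) (i j : Fin (m + 2)) :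
    Setoid (Fin F.ne) :=
  Relation.EqvGen.setoid (fun e e' =>
    (Sum.inr i ∈ F.inc e ∨ Sum.inr j ∈ F.inc e) ∧
    (Sum.inr i ∈ F.inc e' ∨ Sum.inr j ∈ F.inc e'))

noncomputable def contractNE {m : ℕ} (F : Fragment (m + 2)) (i j : Fin (m + 2)) : ℕ :=
  Nat.card (Quotient (contractSetoid F i j))

noncomputable def contractEquiv {m : ℕ} (F : Fragment (m + 2)) (i j : Fin (m + 2)) :
    Fin (contractNE F i j) ≃ Quotient (contractSetoid F i j) :=
  (Finite.equivFin _).symm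

noncomputable def contractInc {m : ℕ} (F : Fragment (m + 2)) (i j : Fin (m + 2))
    (hij : i < j) (c : Fin (contractNE F i j)) : Multiset (Fin F.nv ⊕ Fin m) := by
  classical
  exact ∑ e ∈ Finset.univ.filter
    (fun e => Quotient.mk (contractSetoid F i j) e = contractEquiv F i j c),
    (F.inc e).filterMap (removeEnd i j hij)

/-- The contraction `Γ^k_{i,j}(F)` of a `(m+2)`-fragment: join the half edges
at the open ends labelled `i` and `j` into a single edge (possibly a circle)
and relabel the remaining open ends preserving their order.  (The impossible
degenerate branch is never taken.) -/
noncomputable def fragContract {m : ℕ} (i j : Fin (m + 2)) (hij : i < j)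
    (F : Fragment (m + 2)) : Fragment m := by
  classical
  exact if hc : (∀ c, Multiset.card (contractInc F i j hij c) = 2 ∨
        Multiset.card (contractInc F i j hij c) = 0)
      ∧ (∀ jj : Fin m, (∑ c, (contractInc F i j hij c).count (Sum.inr jj)) = 1) then
    { nv := F.nv
      ne := contractNE F i j
      inc := contractInc F i j hij
      card_inc := hc.1
      openEnd := hc.2 }
  else basicFragment m

/-! ### Zariski closedness, spin models, reductivity -/

/-- A subset of a coordinate space `ι → 𝔽` is Zariski closed if it is the
common zero locus of a set of polynomials. -/
def IsZarClosed {ι : Type} (S : Set (ι → 𝔽)) : Prop :=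
  ∃ P : Set (MvPolynomial ι 𝔽), S = {x | ∀ p ∈ P, MvPolynomial.eval x p = 0}

/-- The vertex model `h(p) = ∑ i, a i • p (u i)` attached to points
`u_1, …, u_m` and coefficients `a_1, …, a_m`. -/
noncomputable def spinModel {m : ℕ} (u : Fin m → (Fin n → 𝔽)) (a : Fin m → 𝔽) :
    VertexModel 𝔽 n :=
  ∑ i, a i • (MvPolynomial.aeval (u i) : MvPolynomial (Fin n) 𝔽 →ₐ[𝔽] 𝔽).toLinearMap

/-- Multi-degrees of total degree at most `e`: coordinates for the space
`(R_{≤ e})^*`. -/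
def LowDeg (n e : ℕ) : Type := {d : Fin n →₀ ℕ // (d.sum fun _ c => c) ≤ e}

/-- The `O_n`-orbit of `h_e` (the restriction of `h` to polynomials of degree
at most `e`), in coordinates. -/
noncomputable def restOrbit (h : VertexModel 𝔽 n) (e : ℕ) : Set (LowDeg n e → 𝔽) :=
  {y | ∃ g ∈ orthSet 𝔽 n, ∀ d : LowDeg n e,
    y d = dualAct g h (MvPolynomial.monomial d.1 (1 : 𝔽))}

/-- The `O_n`-orbit of an `m`-tuple of vectors, in coordinates. -/
def vecOrbit {m : ℕ} (u : Fin m → (Fin n → 𝔽)) : Set (Fin m × Fin n → 𝔽) :=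
  {y | ∃ g ∈ orthSet 𝔽 n, ∀ p : Fin m × Fin n, y p = g.mulVec (u p.1) p.2}

/-- The `O_n`-orbit of an element `w` of `⊕_{k ≤ e} V^{⊗ k}`, in
coordinates. -/
def tensorTupleOrbit (e : ℕ) (w : ∀ k : ℕ, Tensor 𝔽 n k) :
    Set ((Σ p : Fin (e + 1), (Fin p.1 → Fin n)) → 𝔽) :=
  {y | ∃ g ∈ orthSet 𝔽 n, ∀ q : Σ p : Fin (e + 1), (Fin p.1 → Fin n),
    y q = tact g q.1 (w q.1) q.2}

/-- Linear reductivity of a set `H` of `n × n` matrices: in every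
polynomial representation of `H`, every `H`-invariant subspace admits an
`H`-invariant complement. -/
def IsLinRed (H : Set (Matrix (Fin n) (Fin n) 𝔽)) : Prop :=
  ∀ (m : ℕ) (ρ : Matrix (Fin n) (Fin n) 𝔽 → Matrix (Fin m) (Fin m) 𝔽),
    (∀ a b : Fin m, ∃ p : MvPolynomial (Fin n × Fin n) 𝔽,
      ∀ g, ρ g a b = MvPolynomial.eval (fun q => g q.1 q.2) p) →
    (∀ g ∈ H, ∀ g' ∈ H, ρ (g * g') = ρ g * ρ g') → ρ 1 = 1 →
    ∀ W : Submodule 𝔽 (Fin m → 𝔽),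
      (∀ g ∈ H, ∀ w ∈ W, (ρ g).mulVec w ∈ W) →
      ∃ W' : Submodule 𝔽 (Fin m → 𝔽), IsCompl W W' ∧
        (∀ g ∈ H, ∀ w ∈ W', (ρ g).mulVec w ∈ W')

/-- The pointwise stabilizer in `O_n` of a graded family of subspaces of the
tensor algebra. -/
def setStab (A : ∀ k : ℕ, Submodule 𝔽 (Tensor 𝔽 n k)) :
    Set (Matrix (Fin n) (Fin n) 𝔽) :=
  {g | g ∈ orthSet 𝔽 n ∧ ∀ (k : ℕ), ∀ a ∈ A k, tact g k a = a}

/-- The sum of the nontrivial `H`-isotypic components of `V^{⊗ k}`: the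
largest `H`-stable subspace meeting the invariants trivially. -/
def nontrivialPart (H : Set (Matrix (Fin n) (Fin n) 𝔽)) (k : ℕ) :
    Submodule 𝔽 (Tensor 𝔽 n k) :=
  sSup {W | (∀ g ∈ H, ∀ w ∈ W, tact g k w ∈ W) ∧ W ⊓ invSub H k = ⊥}

end

end VertexModels

open VertexModels

namespace LinearMap.BilinForm

open Module
open LinearMap (BilinForm)

/-- Over an algebraically closed field in which `2` is invertible, nondegenerate symmetric bilinear
forms on spaces of the same dimension are isometric. -/
theorem exists_isometry_of_isAlgClosed {K M₁ M₂ : Type*} [Field K] [IsAlgClosed K]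
    [Invertible (2 : K)] [AddCommGroup M₁] [Module K M₁] [FiniteDimensional K M₁]
    [AddCommGroup M₂] [Module K M₂] [FiniteDimensional K M₂]
    {B₁ : BilinForm K M₁} {B₂ : BilinForm K M₂} (hs₁ : B₁.IsSymm) (hs₂ : B₂.IsSymm)
    (hn₁ : B₁.Nondegenerate) (hn₂ : B₂.Nondegenerate) (hd : finrank K M₁ = finrank K M₂) :
    ∃ e : M₁ ≃ₗ[K] M₂, ∀ x y, B₂ (e x) (e y) = B₁ x y := by
  have ha₁ : QuadraticMap.associated B₁.toQuadraticMap = B₁ :=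
    QuadraticMap.associated_left_inverse K hs₁.eq
  have ha₂ : QuadraticMap.associated B₂.toQuadraticMap = B₂ :=
    QuadraticMap.associated_left_inverse K hs₂.eq
  obtain ⟨e₁⟩ := QuadraticForm.equivalent_weightedSumSquares_of_isAlgClosed
    B₁.toQuadraticMap (by rw [ha₁]; exact hn₁.1)
  obtain ⟨e₂⟩ := QuadraticForm.equivalent_weightedSumSquares_of_isAlgClosed
    B₂.toQuadraticMap (by rw [ha₂]; exact hn₂.1)
  rw [← hd] at e₂
  have key : ∀ x, B₂.toQuadraticMap (e₁.trans e₂.symm x) = B₁.toQuadraticMap x :=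
    (e₁.trans e₂.symm).map_app
  refine ⟨(e₁.trans e₂.symm).toLinearEquiv, fun x y => ?_⟩
  rw [← LinearMap.congr_fun₂ ha₁, ← LinearMap.congr_fun₂ ha₂]
  change QuadraticMap.associated B₂.toQuadraticMap (e₁.trans e₂.symm x) (e₁.trans e₂.symm y) = _
  rw [QuadraticMap.associated_apply, QuadraticMap.associated_apply, ← map_add, key, key, key]

/-- **Witt's extension theorem** for a nondegenerate subspace, over an algebraically closed field in
which `2` is invertible. -/
theorem exists_isometry_extending {K V : Type*} [Field K] [IsAlgClosed K]
    [Invertible (2 : K)] [AddCommGroup V] [Module K V] [FiniteDimensional K V]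
    {B : BilinForm K V} (hs : B.IsSymm) (hn : B.Nondegenerate) {U : Submodule K V}
    (hU : (B.restrict U).Nondegenerate) (f : U →ₗ[K] V) (hf : ∀ x y, B (f x) (f y) = B x y) :
    ∃ g : V →ₗ[K] V, (∀ x : U, g x = f x) ∧ ∀ x y, B (g x) (g y) = B x y := by
  have hinj : Function.Injective f := by
    rw [← LinearMap.ker_eq_bot, LinearMap.ker_eq_bot']
    intro x hx
    refine hU.1 x fun y => ?_
    change B x y = 0
    rw [← hf, hx, map_zero, LinearMap.zero_apply]
  have hW : (B.restrict (LinearMap.range f)).Nondegenerate := by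
    refine (hs.restrict _).isRefl.nondegenerate_iff_separatingLeft.mpr ?_
    rintro ⟨_, x, rfl⟩ h
    have : x = 0 := hU.1 x fun y => by
      change B x y = 0
      rw [← hf]
      exact h ⟨f y, y, rfl⟩
    simp [this]
  have hcU := isCompl_orthogonal_of_restrict_nondegenerate hs.isRefl hU
  have perp : ∀ {W : Submodule K V}, (B.restrict W).Nondegenerate →
      (B.restrict (B.orthogonal W)).Nondegenerate := fun {W} hW => by
    rw [restrict_nondegenerate_iff_isCompl_orthogonal hs.isRefl,
      orthogonal_orthogonal hn hs.isRefl]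
    exact (isCompl_orthogonal_of_restrict_nondegenerate hs.isRefl hW).symm
  have hd : finrank K (B.orthogonal U) = finrank K (B.orthogonal (LinearMap.range f)) := by
    rw [finrank_orthogonal hn, finrank_orthogonal hn, LinearMap.finrank_range_of_inj hinj]
  obtain ⟨e, he⟩ := exists_isometry_of_isAlgClosed (hs.restrict _) (hs.restrict _)
    (perp hU) (perp hW) hd
  have he' : ∀ x y, B (e x : V) (e y) = B x y := he
  have hort : ∀ (x : U) (y : B.orthogonal U), B (f x) (e y) = 0 := fun x y =>
    (e y).2 (f x) ⟨x, rfl⟩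
  have hort' : ∀ (x : U) (y : B.orthogonal U), B (x : V) y = 0 := fun x y => y.2 x x.2
  refine ⟨LinearMap.ofIsCompl hcU f ((Submodule.subtype _).comp e.toLinearMap),
    fun x => LinearMap.ofIsCompl_apply_left .., fun x y => ?_⟩
  obtain ⟨x₁, x₂, rfl⟩ : ∃ (a : U) (b : B.orthogonal U), (a + b : V) = x := by
    obtain ⟨a, ha, b, hb, h⟩ := Submodule.mem_sup.1 (hcU.sup_eq_top ▸ Submodule.mem_top (x := x))
    exact ⟨⟨a, ha⟩, ⟨b, hb⟩, h⟩
  obtain ⟨y₁, y₂, rfl⟩ : ∃ (a : U) (b : B.orthogonal U), (a + b : V) = y := by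
    obtain ⟨a, ha, b, hb, h⟩ := Submodule.mem_sup.1 (hcU.sup_eq_top ▸ Submodule.mem_top (x := y))
    exact ⟨⟨a, ha⟩, ⟨b, hb⟩, h⟩
  simp only [map_add, LinearMap.ofIsCompl_apply_left, LinearMap.ofIsCompl_apply_right,
    LinearMap.add_apply, LinearMap.comp_apply, Submodule.subtype_apply, LinearEquiv.coe_coe,
    hf, he', hort, hort', hs.eq (e x₂ : V), hs.eq (x₂ : V)]

end LinearMap.BilinForm

namespace VertexModels

variable {𝔽 : Type} [Field 𝔽] {n m : ℕ}

/-- A matrix lies in `O_n` iff it preserves the standard bilinear form. -/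
theorem mem_orthSet_iff {g : Matrix (Fin n) (Fin n) 𝔽} :
    g ∈ orthSet 𝔽 n ↔ ∀ v w, g.mulVec v ⬝ᵥ g.mulVec w = v ⬝ᵥ w := by
  have key : ∀ v w, g.mulVec v ⬝ᵥ g.mulVec w = v ⬝ᵥ (g.transpose * g).mulVec w := fun v w => by
    rw [← Matrix.mulVec_mulVec, Matrix.dotProduct_mulVec v, Matrix.vecMul_transpose]
  simp only [key]
  constructor
  · intro h v w
    rw [show g.transpose * g = 1 from h, Matrix.one_mulVec]
  · intro h
    refine Matrix.ext_of_mulVec_single fun i => ?_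
    rw [Matrix.one_mulVec]
    exact dotProduct_eq _ _ fun w => by rw [dotProduct_comm, h, dotProduct_comm]

/-- If `x, z` is a hyperbolic pair then the map scaling `x` by `t` and `z` by `t⁻¹`, and fixing the
orthogonal complement of both, is orthogonal. -/
theorem one_add_vecMulVec_mem_orthSet {x z : Fin n → 𝔽} (hx : x ⬝ᵥ x = 0) (hz : z ⬝ᵥ z = 0)
    (hxz : x ⬝ᵥ z = 1) {t : 𝔽} (ht : t ≠ 0) :
    1 + (t - 1) • Matrix.vecMulVec x z + (t⁻¹ - 1) • Matrix.vecMulVec z x ∈ orthSet 𝔽 n := by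
  rw [mem_orthSet_iff]
  intro v w
  have hzx : z ⬝ᵥ x = 1 := by rw [dotProduct_comm, hxz]
  simp only [Matrix.add_mulVec, Matrix.one_mulVec, Matrix.smul_mulVec, Matrix.vecMulVec_mulVec,
    add_dotProduct, dotProduct_add, smul_dotProduct, dotProduct_smul, op_smul_eq_smul, smul_eq_mul,
    hx, hz, hxz, hzx, dotProduct_comm v]
  field_simp
  ring

/-- A nonzero isotropic vector is part of a hyperbolic pair. -/
theorem exists_hyperbolic_pair [NeZero (2 : 𝔽)] {x : Fin n → 𝔽} (hx : x ⬝ᵥ x = 0) (hx0 : x ≠ 0) :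
    ∃ z : Fin n → 𝔽, z ⬝ᵥ z = 0 ∧ x ⬝ᵥ z = 1 := by
  obtain ⟨k, hk⟩ := Function.ne_iff.1 hx0
  set w : Fin n → 𝔽 := Pi.single k (x k)⁻¹ with hw
  have hxw : x ⬝ᵥ w = 1 := by
    rw [hw, dotProduct_single, mul_inv_cancel₀ hk]
  have hwx : w ⬝ᵥ x = 1 := by rw [dotProduct_comm, hxw]
  refine ⟨w - ((w ⬝ᵥ w) / 2) • x, ?_, ?_⟩
  · simp only [sub_dotProduct, dotProduct_sub, smul_dotProduct, dotProduct_smul, smul_eq_mul,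
      hxw, hwx, hx]
    field_simp
    ring
  · simp only [dotProduct_sub, dotProduct_smul, hxw, hx, smul_zero, sub_zero]

/-- If all points of an affine line except possibly the one at parameter `0` lie in a Zariski closed
set, then so does that one. -/
theorem IsZarClosed.mem_of_line [Infinite 𝔽] {ι : Type} {S : Set (ι → 𝔽)} (hS : IsZarClosed S)
    (a b : ι → 𝔽) (h : ∀ t : 𝔽, t ≠ 0 → a + t • b ∈ S) : a ∈ S := by
  obtain ⟨P, rfl⟩ := hS
  intro p hp
  let q : Polynomial 𝔽 :=
    MvPolynomial.aeval (fun i => Polynomial.C (a i) + Polynomial.X * Polynomial.C (b i)) p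
  have hq : ∀ t, q.eval t = MvPolynomial.eval (a + t • b) p := fun t => by
    have := MvPolynomial.map_aeval
      (fun i => Polynomial.C (a i) + Polynomial.X * Polynomial.C (b i)) (Polynomial.evalRingHom t) p
    simp only [Polynomial.coe_evalRingHom] at this
    rw [this, MvPolynomial.coe_eval₂Hom, MvPolynomial.eval, MvPolynomial.coe_eval₂Hom]
    congr 1
    · ext; simp
    · funext i; simp [mul_comm t]
  have hq0 : q = 0 := Polynomial.eq_zero_of_infinite_isRoot q <|
    (Set.finite_singleton (0 : 𝔽)).infinite_compl.mono fun t ht => by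
      change q.eval t = 0
      rw [hq]
      exact h t ht p hp
  have := hq 0
  rw [hq0, zero_smul, add_zero, Polynomial.eval_zero] at this
  exact this.symm

/-- If the span of the `uᵢ` is nondegenerate, the orbit of `u` consists of the tuples which have the
same Gram matrix as `u` and satisfy all linear relations between the `uᵢ`. -/
theorem mem_vecOrbit_iff [IsAlgClosed 𝔽] [CharZero 𝔽] {u : Fin m → (Fin n → 𝔽)}
    (hu : ∀ x ∈ Submodule.span 𝔽 (Set.range u),
      (∀ y ∈ Submodule.span 𝔽 (Set.range u), x ⬝ᵥ y = 0) → x = 0) (y : Fin m × Fin n → 𝔽) :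
    y ∈ vecOrbit u ↔ (∀ i j, ∑ a, y (i, a) * y (j, a) = u i ⬝ᵥ u j) ∧
      ∀ c : Fin m → 𝔽, ∑ i, c i • u i = 0 → ∀ a, ∑ i, c i * y (i, a) = 0 := by
  constructor
  · rintro ⟨g, hg, h⟩
    simp only [h]
    refine ⟨fun i j => mem_orthSet_iff.1 hg (u i) (u j), fun c hc a => ?_⟩
    have := congrFun (congrArg g.mulVec hc) a
    simpa [Matrix.mulVec_sum, Matrix.mulVec_smul] using this
  · rintro ⟨hG, hR⟩
    let v : Fin m → (Fin n → 𝔽) := fun i a => y (i, a)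
    have hG' : ∀ i j, v i ⬝ᵥ v j = u i ⬝ᵥ u j := hG
    let B : LinearMap.BilinForm 𝔽 (Fin n → 𝔽) := dotProductBilin 𝔽 𝔽
    have hBs : B.IsSymm := ⟨fun x y : Fin n → 𝔽 => dotProduct_comm x y⟩
    have hBn : B.Nondegenerate := hBs.isRefl.nondegenerate_iff_separatingLeft.2 fun x hx =>
      dotProduct_eq_zero x hx
    have : Invertible (2 : 𝔽) := invertibleOfNonzero two_ne_zero
    set U := Submodule.span 𝔽 (Set.range u) with hU
    have hBU : (B.restrict U).Nondegenerate :=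
      (hBs.restrict U).isRefl.nondegenerate_iff_separatingLeft.2 fun x hx =>
        Subtype.ext (hu x x.2 fun y hy => hx ⟨y, hy⟩)
    obtain ⟨f, hf⟩ : ∃ f : (Fin n → 𝔽) →ₗ[𝔽] (Fin n → 𝔽),
        f ∘ₗ Fintype.linearCombination 𝔽 u = Fintype.linearCombination 𝔽 v := by
      have hk : LinearMap.ker (Fintype.linearCombination 𝔽 u) ≤
          LinearMap.ker (Fintype.linearCombination 𝔽 v) := fun c hc => by
        rw [LinearMap.mem_ker, Fintype.linearCombination_apply] at hc ⊢
        funext a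
        simpa [v] using hR c hc a
      obtain ⟨r, hr⟩ := LinearMap.exists_leftInverse_of_injective _
        (Submodule.ker_liftQ_eq_bot' _ (Fintype.linearCombination 𝔽 u) rfl)
      refine ⟨Submodule.liftQ _ _ hk ∘ₗ r, LinearMap.ext fun c => ?_⟩
      have hrc : r (Fintype.linearCombination 𝔽 u c) = Submodule.Quotient.mk c :=
        LinearMap.congr_fun hr (Submodule.Quotient.mk c)
      rw [LinearMap.comp_apply, LinearMap.comp_apply, hrc, Submodule.liftQ_apply]
    have hfu : ∀ i, f (u i) = v i := fun i => by
      simpa using LinearMap.congr_fun hf (Pi.single i 1)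
    obtain ⟨g, hgf, hg⟩ := LinearMap.BilinForm.exists_isometry_extending hBs hBn hBU
      (f.domRestrict U) (by
        rintro ⟨x, hx⟩ ⟨y, hy⟩
        obtain ⟨c, rfl⟩ := (Submodule.mem_span_range_iff_exists_fun 𝔽).1 hx
        obtain ⟨d, rfl⟩ := (Submodule.mem_span_range_iff_exists_fun 𝔽).1 hy
        change f (∑ i, c i • u i) ⬝ᵥ f (∑ i, d i • u i) = (∑ i, c i • u i) ⬝ᵥ ∑ i, d i • u i
        simp only [map_sum, map_smul, hfu, sum_dotProduct, dotProduct_sum, smul_dotProduct,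
          dotProduct_smul, hG'])
    refine ⟨LinearMap.toMatrix' g, mem_orthSet_iff.2 fun v w => ?_, fun p => ?_⟩
    · rw [LinearMap.toMatrix'_mulVec, LinearMap.toMatrix'_mulVec]
      exact hg v w
    · have := hgf ⟨u p.1, Submodule.subset_span ⟨p.1, rfl⟩⟩
      rw [LinearMap.toMatrix'_mulVec, this]
      exact (congrFun (hfu p.1) p.2).symm

/-- If the span of the `uᵢ` is nondegenerate, the orbit of `u` is Zariski closed. -/
theorem isZarClosed_vecOrbit [IsAlgClosed 𝔽] [CharZero 𝔽] {u : Fin m → (Fin n → 𝔽)}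
    (hu : ∀ x ∈ Submodule.span 𝔽 (Set.range u),
      (∀ y ∈ Submodule.span 𝔽 (Set.range u), x ⬝ᵥ y = 0) → x = 0) :
    IsZarClosed (vecOrbit u) := by
  refine ⟨{p | ∃ i j, p = ∑ a, X (i, a) * X (j, a) - C (u i ⬝ᵥ u j)} ∪
    {p | ∃ c : Fin m → 𝔽, ∑ i, c i • u i = 0 ∧ ∃ a, p = ∑ i, C (c i) * X (i, a)}, ?_⟩
  ext y
  rw [mem_vecOrbit_iff hu]
  constructor
  · rintro ⟨hG, hR⟩ p (⟨i, j, rfl⟩ | ⟨c, hc, a, rfl⟩)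
    · simp [hG]
    · simpa using hR c hc a
  · intro h
    refine ⟨fun i j => ?_, fun c hc a => ?_⟩
    · simpa [sub_eq_zero] using h _ (Or.inl ⟨i, j, rfl⟩)
    · simpa using h _ (Or.inr ⟨c, hc, a, rfl⟩)

/-- If the orbit of `u` is Zariski closed, the span of the `uᵢ` is nondegenerate. -/
theorem eq_zero_of_isZarClosed_vecOrbit [CharZero 𝔽] {u : Fin m → (Fin n → 𝔽)}
    (h : IsZarClosed (vecOrbit u)) {x : Fin n → 𝔽} (hx : x ∈ Submodule.span 𝔽 (Set.range u))
    (hxu : ∀ y ∈ Submodule.span 𝔽 (Set.range u), x ⬝ᵥ y = 0) : x = 0 := by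
  by_contra hx0
  have hxx := hxu x hx
  obtain ⟨z, hz, hxz⟩ := exists_hyperbolic_pair hxx hx0
  have hxu' : ∀ i, x ⬝ᵥ u i = 0 := fun i => hxu _ (Submodule.subset_span ⟨i, rfl⟩)
  obtain ⟨g, hg, hgu⟩ := h.mem_of_line (fun p => (u p.1 - (z ⬝ᵥ u p.1) • x) p.2)
    (fun p => ((z ⬝ᵥ u p.1) • x) p.2) fun t ht =>
      ⟨_, one_add_vecMulVec_mem_orthSet hxx hz hxz ht, fun p => by
        simp only [Matrix.add_mulVec, Matrix.one_mulVec, Matrix.smul_mulVec,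
          Matrix.vecMulVec_mulVec, op_smul_eq_smul, hxu', Pi.add_apply, Pi.smul_apply,
          Pi.sub_apply, smul_eq_mul]
        ring⟩
  have hspan : ∀ v ∈ Submodule.span 𝔽 (Set.range u), g.mulVec v = v - (z ⬝ᵥ v) • x := by
    intro v hv
    induction hv using Submodule.span_induction with
    | mem v hv =>
      obtain ⟨i, rfl⟩ := hv
      exact funext fun a => (hgu (i, a)).symm
    | zero => simp
    | add v w _ _ hv hw => rw [Matrix.mulVec_add, hv, hw, dotProduct_add, add_smul]; abel
    | smul c v _ hv => rw [Matrix.mulVec_smul, hv, dotProduct_smul, smul_sub, smul_assoc]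
  have hgx : g.mulVec x = 0 := by
    rw [hspan x hx, dotProduct_comm, hxz, one_smul, sub_self]
  refine hx0 ?_
  rw [← Matrix.one_mulVec x, ← show g.transpose * g = 1 from hg, ← Matrix.mulVec_mulVec, hgx,
    Matrix.mulVec_zero]

end VertexModels

/-- The `O_n`-orbit of a tuple `(u_1, …, u_m) ∈ V^m` is Zariski closed if and
only if the restriction of the standard bilinear form to the span of the `uᵢ`
is nondegenerate. -/
theorem vecOrbit_closed_iff_nondeg (𝔽 : Type) [Field 𝔽] [IsAlgClosed 𝔽]
    [CharZero 𝔽] (n m : ℕ) (u : Fin m → (Fin n → 𝔽)) :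
    IsZarClosed (vecOrbit u) ↔
      ∀ x ∈ Submodule.span 𝔽 (Set.range u),
        (∀ y ∈ Submodule.span 𝔽 (Set.range u), (∑ i, x i * y i) = 0) → x = 0 :=
  ⟨fun h _ hx hxu => eq_zero_of_isZarClosed_vecOrbit h hx hxu, isZarClosed_vecOrbit⟩
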